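/- Let n ≥ 4 and let ρ_a, ρ_b, ρ_c be n×n complex pure states (Hermitian, ρ² = ρ, Tr ρ = 1) with Tr(ρ_a ρ_b) = Tr(ρ_b ρ_c) = Tr(ρ_a ρ_c) = 1/(n+1). For θ ∈ ℝ define M(θ) = ((2/3)cos θ + 1/3)ρ_a + (-(1/3)cos θ + (1/√3)sin θ + 1/3)ρ_b + (-(1/3)cos θ - (1/√3)sin θ + 1/3)ρ_c. Then there exists θ ∈ ℝ with Tr(M(θ)³) ≠ 1; in particular, not every matrix M(θ) on this circle is a pure state. -/

import Mathlib

open Matrix Real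

/-- The trace of the cube of a linear combination of three idempotent matrices. -/
theorem trace_cube_of_idempotents {ι R : Type*} [Fintype ι] [DecidableEq ι] [CommRing R]
    {A B C : Matrix ι ι R} (hA : A * A = A) (hB : B * B = B) (hC : C * C = C) (x y z : R) :
    ((x • A + y • B + z • C) ^ 3).trace =
      x ^ 3 * A.trace + y ^ 3 * B.trace + z ^ 3 * C.trace
        + 3 * (x ^ 2 * y + x * y ^ 2) * (A * B).trace
        + 3 * (y ^ 2 * z + y * z ^ 2) * (B * C).trace
        + 3 * (x ^ 2 * z + x * z ^ 2) * (A * C).trace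
        + 3 * x * y * z * ((A * B * C).trace + (A * C * B).trace) := by
  have sandwich {P : Matrix ι ι R} (hP : P * P = P) (Q : Matrix ι ι R) :
      (P * Q * P).trace = (P * Q).trace := by
    rw [trace_mul_comm, ← mul_assoc, hP]
  have hBAC : (B * A * C).trace = (A * C * B).trace := by rw [mul_assoc, trace_mul_comm]
  have hBCA : (B * C * A).trace = (A * B * C).trace := by
    rw [trace_mul_comm, mul_assoc]
  have hCAB : (C * A * B).trace = (A * B * C).trace := by rw [mul_assoc, trace_mul_comm]
  have hCBA : (C * B * A).trace = (A * C * B).trace := by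
    rw [trace_mul_comm, mul_assoc]
  have cancel {P : Matrix ι ι R} (hP : P * P = P) (Q : Matrix ι ι R) : Q * P * P = Q * P := by
    rw [mul_assoc, hP]
  simp only [pow_three', mul_add, add_mul, smul_mul_assoc, mul_smul_comm, trace_add, trace_smul,
    smul_eq_mul, hA, hB, hC, cancel hA, cancel hB, cancel hC, sandwich hA, sandwich hB,
    sandwich hC, hBAC, hBCA, hCAB, hCBA, trace_mul_comm B A, trace_mul_comm C A,
    trace_mul_comm C B]
  ring

open scoped ComplexOrder in
/-- A complex matrix whose Gram trace is a nonpositive real number vanishes. -/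
theorem eq_zero_of_trace_conjTranspose_mul_self_nonpos {m n : Type*} [Fintype m] [Fintype n]
    {X : Matrix m n ℂ} {r : ℝ} (hX : (Xᴴ * X).trace = r) (hr : r ≤ 0) : X = 0 := by
  have hnonneg := (posSemidef_conjTranspose_mul_self X).trace_nonneg
  rw [hX] at hnonneg
  rw [le_antisymm hr (by exact_mod_cast hnonneg), Complex.ofReal_zero] at hX
  exact trace_conjTranspose_mul_self_eq_zero_iff.1 hX

/-- Core of Theorem 2 of the paper: in dimension `n ≥ 4`, the cubic purity function cannot be
constantly `1` along the circle `θ ↦ M(θ)` through three pure states with pairwise SIC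
overlaps `1/(n+1)`; there is a `θ` with `Tr(M(θ)³) ≠ 1`, so not every `M(θ)` is pure. -/
theorem trace_cube_not_constant_on_circle (n : ℕ) (hn : 4 ≤ n)
    (ρa ρb ρc : Matrix (Fin n) (Fin n) ℂ)
    (hah : ρa.IsHermitian) (ha2 : ρa * ρa = ρa) (hatr : ρa.trace = 1)
    (hbh : ρb.IsHermitian) (hb2 : ρb * ρb = ρb) (hbtr : ρb.trace = 1)
    (hch : ρc.IsHermitian) (hc2 : ρc * ρc = ρc) (hctr : ρc.trace = 1)
    (hab : (ρa * ρb).trace = 1 / ((n : ℂ) + 1))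
    (hbc : (ρb * ρc).trace = 1 / ((n : ℂ) + 1))
    (hac : (ρa * ρc).trace = 1 / ((n : ℂ) + 1)) :
    ∃ θ : ℝ,
      ((((2 / 3 * cos θ + 1 / 3 : ℝ) : ℂ) • ρa +
        ((-(1 / 3) * cos θ + (1 / Real.sqrt 3) * sin θ + 1 / 3 : ℝ) : ℂ) • ρb +
        ((-(1 / 3) * cos θ - (1 / Real.sqrt 3) * sin θ + 1 / 3 : ℝ) : ℂ) • ρc) ^ 3).trace
        ≠ 1 := by
  by_contra! h
  have hn1 : (n : ℂ) + 1 ≠ 0 := by exact_mod_cast n.succ_ne_zero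
  have hpi := h π
  rw [trace_cube_of_idempotents ha2 hb2 hc2, hatr, hbtr, hctr, hab, hbc, hac] at hpi
  simp only [cos_pi, sin_pi] at hpi
  push_cast at hpi
  have htriple : (ρa * ρb * ρc).trace + (ρa * ρc * ρb).trace = 3 * (1 / ((n : ℂ) + 1)) - 1 := by
    linear_combination (-9 / 4 : ℂ) * hpi
  have hgram : (((ρa + ρc) * ρb)ᴴ * ((ρa + ρc) * ρb)).trace = (((4 - n) / (n + 1) : ℝ) : ℂ) := by
    have hexpand : (((ρa + ρc) * ρb)ᴴ * ((ρa + ρc) * ρb)).trace =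
        (ρa * ρb).trace + (ρb * ρc).trace
          + ((ρa * ρb * ρc).trace + (ρa * ρc * ρb).trace) := by
      rw [conjTranspose_mul, conjTranspose_add, hah.eq, hbh.eq, hch.eq, mul_assoc, trace_mul_comm,
        mul_assoc, mul_assoc, hb2, ← mul_assoc, trace_mul_comm ρb ρc, trace_mul_comm (ρa * ρb) ρc,
        ← mul_assoc]
      simp only [mul_add, add_mul, ha2, hc2, trace_add]
      ring
    rw [hexpand, hab, hbc, htriple]
    push_cast
    field_simp
    ring
  have hnonpos : ((4 - n) / (n + 1) : ℝ) ≤ 0 :=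
    div_nonpos_of_nonpos_of_nonneg (sub_nonpos.2 (by exact_mod_cast hn)) (by positivity)
  have hzero := eq_zero_of_trace_conjTranspose_mul_self_nonpos hgram hnonpos
  have htrace : (ρa * ρb).trace + (ρb * ρc).trace = 0 := by
    rw [trace_mul_comm ρb ρc, ← trace_add, ← add_mul, hzero, trace_zero]
  rw [hab, hbc, ← two_mul] at htrace
  exact mul_ne_zero two_ne_zero (one_div_ne_zero hn1) htrace
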